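/- For every imprecise probability tree 𝒫, every upper expectation tree Q̄, and every situation s, the restrictions of Ē_𝒫(·|s) and of Ē_Q̄(·|s) to the functions Ω → [0,∞] are Ω-capacities, i.e. they satisfy CA1 (monotonicity), CA2 (continuity along pointwise nondecreasing sequences of functions Ω → [0,∞]), and CA3 (continuity along pointwise non-increasing sequences of upper semicontinuous functions Ω → [0,∞)). -/

import Mathlib

open Filter MeasureTheory Topology
open scoped ENNReal

namespace UEPaper

variable {X : Type} [Fintype X] [Nonempty X] [DecidableEq X]

/-- The set of paths: infinite sequences of states (`ω i` is the `(i+1)`-th state). -/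
abbrev Path (X : Type) := ℕ → X

/-- The prefix `ω^k` of length `k` of a path, as a list (a situation). -/
def prefixList (ω : Path X) (k : ℕ) : List X := (List.range k).map ω

/-- The cylinder event `Γ(s)` of a situation `s`. -/
def cyl (s : List X) : Set (Path X) := {ω | prefixList ω s.length = s}

/-- `f` is `n`-measurable: it depends only on the first `n` states. -/
def NMeas (n : ℕ) (f : Path X → EReal) : Prop :=
  ∀ ω ω' : Path X, prefixList ω n = prefixList ω' n → f ω = f ω'

/-- A gamble: a bounded real-valued global variable. -/
def IsGamble (f : Path X → EReal) : Prop :=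
  ∃ B : ℝ, ∀ ω, -(B : EReal) ≤ f ω ∧ f ω ≤ (B : EReal)

/-- A finitary gamble: an `n`-measurable gamble for some `n`. -/
def IsFinGamble (f : Path X → EReal) : Prop :=
  (∃ n, NMeas n f) ∧ IsGamble f

/-- An upper expectation tree: a coherent upper expectation at each situation. -/
structure UpperExpTree (X : Type) [Fintype X] [Nonempty X] where
  Q : List X → (X → ℝ) → ℝ
  le_sup : ∀ (s : List X) (f : X → ℝ), Q s f ≤ ⨆ x, f x
  subadd : ∀ (s : List X) (f g : X → ℝ), Q s (f + g) ≤ Q s f + Q s g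
  pos_homog : ∀ (s : List X) (l : ℝ) (f : X → ℝ), 0 ≤ l → Q s (l • f) = l * Q s f

/-- A (real-valued) supermartingale for the upper expectation tree `Q`. -/
def IsSupermart (Q : UpperExpTree X) (M : List X → ℝ) : Prop :=
  ∀ s : List X, Q.Q s (fun x => M (s ++ [x])) ≤ M s

/-- The game-theoretic upper expectation of a real-valued variable (used on gambles):
the infimum of `M s` over bounded-below supermartingales `M` with
`liminf_k M(ω^k) ≥ f(ω)` on `Γ(s)`. -/
noncomputable def gtG (Q : UpperExpTree X) (f : Path X → ℝ) (s : List X) : EReal :=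
  sInf {a : EReal | ∃ M : List X → ℝ, IsSupermart Q M ∧ (∃ B : ℝ, ∀ t, B ≤ M t) ∧
    (∀ ω ∈ cyl s,
      (f ω : EReal) ≤ Filter.liminf (fun k => ((M (prefixList ω k) : ℝ) : EReal)) atTop) ∧
    a = ((M s : ℝ) : EReal)}

/-- Extension to bounded-below variables, by continuity w.r.t. upper cuts:
`Ē(f|s) = lim_{c → +∞} Ē(min(f,c)|s)` (the limit of this nondecreasing net is a supremum). -/
noncomputable def gtBB (Q : UpperExpTree X) (f : Path X → EReal) (s : List X) : EReal :=
  ⨆ c : ℝ, gtG Q (fun ω => (f ω ⊓ (c : EReal)).toReal) s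

/-- The game-theoretic global upper expectation `Ē_Q̄`, extended to all extended
real variables by continuity w.r.t. lower cuts:
`Ē(f|s) = lim_{c → −∞} Ē(max(f,c)|s)` (the limit of this nonincreasing net is an infimum). -/
noncomputable def gtUE (Q : UpperExpTree X) (f : Path X → EReal) (s : List X) : EReal :=
  ⨅ c : ℝ, gtBB Q (fun ω => f ω ⊔ (c : EReal)) s

/-- A precise probability tree: a probability mass function at each situation. -/
structure PreciseTree (X : Type) [Fintype X] where
  p : List X → X → ℝ
  nonneg : ∀ (s : List X) (x : X), 0 ≤ p s x
  sum_one : ∀ s : List X, ∑ x, p s x = 1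

/-- An imprecise probability tree: a nonempty closed convex set of probability mass
functions at each situation. -/
structure ImpreciseTree (X : Type) [Fintype X] where
  sets : List X → Set (X → ℝ)
  nonempty' : ∀ s : List X, (sets s).Nonempty
  closed' : ∀ s : List X, IsClosed (sets s)
  convex' : ∀ s : List X, Convex ℝ (sets s)
  prob' : ∀ s : List X, ∀ q ∈ sets s, (∀ x, 0 ≤ q x) ∧ ∑ x, q x = 1

/-- `p ∼ 𝒫`: the precise tree `p` is compatible with the imprecise tree `P`. -/
def Compatible (p : PreciseTree X) (P : ImpreciseTree X) : Prop :=
  ∀ s : List X, p.p s ∈ P.sets s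

/-- The probability `P_p(Γ(z)|s)` of the cylinder of `z` conditional on situation `s`. -/
noncomputable def cylProb (p : List X → X → ℝ) (s z : List X) : ℝ :=
  if s.length < z.length ∧ z.take s.length = s then
    ∏ i ∈ Finset.Ico s.length z.length, p (z.take i) (z.getD i (Classical.arbitrary X))
  else if z.length ≤ s.length ∧ s.take z.length = z then 1 else 0

/-- The σ-algebra `ℱ` on paths generated by the cylinder events. -/
instance cylSigma : MeasurableSpace (Path X) :=
  MeasurableSpace.generateFrom {A | ∃ s : List X, A = cyl s}

/-- `μ` is the probability measure `P_p(·|s)` on `ℱ` determined by the tree `p`. -/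
def IsTreeMeasure (p : PreciseTree X) (s : List X) (μ : Measure (Path X)) : Prop :=
  IsProbabilityMeasure μ ∧ ∀ z : List X, μ (cyl z) = ENNReal.ofReal (cylProb p.p s z)

/-- Positive part of an extended real, in `ℝ≥0∞`. -/
noncomputable def posPart (x : EReal) : ℝ≥0∞ := if x = ⊤ then ⊤ else ENNReal.ofReal x.toReal

/-- The Lebesgue integral `∫ g dμ = ∫ g⁺ dμ − ∫ g⁻ dμ` of an extended-real variable
(well-defined, with value in `(-∞, +∞]`, for bounded-below measurable `g`). -/
noncomputable def integralE (μ : Measure (Path X)) (g : Path X → EReal) : EReal :=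
  ((∫⁻ ω, posPart (g ω) ∂μ : ℝ≥0∞) : EReal) - ((∫⁻ ω, posPart (-(g ω)) ∂μ : ℝ≥0∞) : EReal)

/-- The upper integral `Ē_p(f|s)`: infimum of integrals of bounded-below
`ℱ`-measurable variables dominating `f`. -/
noncomputable def upperInt (μ : Measure (Path X)) (f : Path X → EReal) : EReal :=
  sInf {a : EReal | ∃ g : Path X → EReal, Measurable g ∧ (∃ B : ℝ, ∀ ω, (B : EReal) ≤ g ω) ∧
    (∀ ω, f ω ≤ g ω) ∧ a = integralE μ g}

/-- The measure-theoretic global upper expectation `Ē_𝒫(f|s)`, given the assignment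
`Pm` of the measures `P_p(·|s)` to precise trees: the upper envelope of the upper
integrals over all compatible precise trees. -/
noncomputable def muUE (Pm : PreciseTree X → List X → Measure (Path X))
    (P : ImpreciseTree X) (f : Path X → EReal) (s : List X) : EReal :=
  ⨆ (p : PreciseTree X) (_ : Compatible p P), upperInt (Pm p s) f

/-- The trees `P` and `Q` agree: each `Q̄_s` is the upper envelope of the expectations
corresponding to the credal set `𝒫_s`. -/
def Agree (P : ImpreciseTree X) (Q : UpperExpTree X) : Prop :=
  ∀ (s : List X) (f : X → ℝ),
    Q.Q s f = sSup {r : ℝ | ∃ q ∈ P.sets s, r = ∑ x, f x * q x}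

/-- Axioms P1–P5 for a global upper expectation `E` w.r.t. the tree `Q`. -/
structure Axioms (Q : UpperExpTree X) (E : (Path X → EReal) → List X → EReal) : Prop where
  p1 : ∀ (f : X → ℝ) (s : List X),
    E (fun ω => ((f (ω s.length) : ℝ) : EReal)) s = ((Q.Q s f : ℝ) : EReal)
  p2 : ∀ f : Path X → EReal, IsFinGamble f → ∀ s : List X, E f s = E ((cyl s).indicator f) s
  p3 : ∀ f : Path X → EReal, IsFinGamble f → ∀ s : List X,
    E f s ≤ E (fun ω => E f (prefixList ω (s.length + 1))) s
  p4 : ∀ f g : Path X → EReal, (∀ ω, f ω ≤ g ω) → ∀ s : List X, E f s ≤ E g s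
  p5 : ∀ (s : List X) (fn : ℕ → Path X → EReal) (f : Path X → EReal),
    (∀ n, IsFinGamble (fn n)) → (∃ B : ℝ, ∀ n ω, (B : EReal) ≤ fn n ω) →
    (∀ ω, Tendsto (fun n => fn n ω) atTop (nhds (f ω))) →
    E f s ≤ limsup (fun n => E (fn n) s) atTop

/-- Upper semicontinuity of an extended-real variable on the path space. -/
def USC [TopologicalSpace X] [DiscreteTopology X] (f : Path X → EReal) : Prop :=
  ∀ a : ℝ, IsOpen {ω : Path X | f ω < (a : EReal)}

/-- An `Ω`-capacity (Dellacherie): a monotone `[0,∞]`-valued functional on nonnegative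
variables, continuous along nondecreasing sequences, and continuous along
nonincreasing sequences of nonnegative real-valued upper semicontinuous functions. -/
def IsCapacity [TopologicalSpace X] [DiscreteTopology X]
    (F : (Path X → EReal) → EReal) : Prop :=
  (∀ f : Path X → EReal, (∀ ω, 0 ≤ f ω) → 0 ≤ F f) ∧
  (∀ f g : Path X → EReal, (∀ ω, 0 ≤ f ω) → (∀ ω, 0 ≤ g ω) → (∀ ω, f ω ≤ g ω) → F f ≤ F g) ∧
  (∀ fn : ℕ → Path X → EReal, (∀ n ω, 0 ≤ fn n ω) → Monotone fn →
    Tendsto (fun n => F (fn n)) atTop (nhds (F (fun ω => ⨆ n, fn n ω)))) ∧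
  (∀ fn : ℕ → Path X → EReal, (∀ n ω, 0 ≤ fn n ω ∧ fn n ω < ⊤) → (∀ n, USC (fn n)) →
    Antitone fn →
    Tendsto (fun n => F (fn n)) atTop (nhds (F (fun ω => ⨅ n, fn n ω))))

open Classical in
/-- The metric `δ(ω,ω') = 2^{-n}`, `n` the first (1-based) index where `ω` and `ω'` differ. -/
noncomputable def delta (ω ω' : Path X) : ℝ :=
  if h : ω = ω' then 0
  else (1 / 2 : ℝ) ^ (Nat.find (Function.ne_iff.mp h) + 1)

/-- The product topology on the path space (with `X` discrete). -/
def prodTop (X : Type) : TopologicalSpace (ℕ → X) :=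
  @Pi.topologicalSpace ℕ (fun _ => X) (fun _ => ⊥)

set_option linter.unusedSectionVars false

/-! ### Situations and paths -/

theorem prefixList_eq_iff (ω ω' : Path X) (n : ℕ) :
    prefixList ω n = prefixList ω' n ↔ ∀ i < n, ω i = ω' i := by
  simp [prefixList, List.map_inj_left]

@[simp]
theorem length_prefixList (ω : Path X) (n : ℕ) : (prefixList ω n).length = n := by
  simp [prefixList]

theorem prefixList_succ (ω : Path X) (n : ℕ) : prefixList ω (n + 1) = prefixList ω n ++ [ω n] := by
  simp [prefixList, List.range_succ]

theorem prefixList_prefix (ω : Path X) {k m : ℕ} (h : k ≤ m) :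
    prefixList ω k <+: prefixList ω m := by
  induction m, h using Nat.le_induction with
  | base => exact List.prefix_refl _
  | succ m _ ih =>
    rw [prefixList_succ]
    exact ih.trans (List.prefix_append _ _)

theorem mem_cyl_prefixList (ω : Path X) (k : ℕ) : ω ∈ cyl (prefixList ω k) := by
  simp [cyl]

theorem prefix_prefixList {s : List X} {ω : Path X} (h : ω ∈ cyl s) {k : ℕ} (hk : s.length ≤ k) :
    s <+: prefixList ω k := by
  have h' : prefixList ω s.length = s := h
  have := prefixList_prefix ω hk
  rwa [h'] at this

theorem cyl_subset_of_prefix {s t : List X} (h : s <+: t) : cyl t ⊆ cyl s := by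
  intro ω hω
  have h1 : prefixList ω t.length = t := hω
  have h2 : prefixList ω s.length <+: t := by
    have := prefixList_prefix ω h.length_le
    rwa [h1] at this
  exact (List.prefix_of_prefix_length_le h2 h (by simp)).eq_of_length (by simp)

theorem cyl_nonempty (s : List X) : (cyl s).Nonempty := by
  refine ⟨fun i => s.getD i (Classical.arbitrary X), ?_⟩
  refine List.ext_getElem (by simp) fun i h1 h2 => ?_
  simp [prefixList, h2]

/-- A rule choosing a next state in every situation generates a path through any given situation. -/
theorem exists_path_following (next : List X → X) (t : List X) :
    ∃ ω ∈ cyl t, ∀ k, t.length ≤ k → ω k = next (prefixList ω k) := by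
  let L : ℕ → List X := fun n => Nat.rec t (fun _ l => l ++ [next l]) n
  let ω : Path X := fun i => if i < t.length then t.getD i (Classical.arbitrary X)
    else next (L (i - t.length))
  have h0 : ω ∈ cyl t := by
    refine List.ext_getElem (by simp) fun i h1 h2 => ?_
    simp [prefixList, ω, h2]
  have hL : ∀ n, prefixList ω (t.length + n) = L n := by
    intro n
    induction n with
    | zero => exact h0
    | succ n ih =>
      rw [← add_assoc, prefixList_succ, ih]
      simp [ω, L]
  refine ⟨ω, h0, fun k hk => ?_⟩
  obtain ⟨n, rfl⟩ := Nat.exists_eq_add_of_le hk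
  rw [hL]
  simp [ω]

/-! ### Upper expectations and supermartingales -/

namespace UpperExpTree

theorem Q_le_const (Q : UpperExpTree X) (s : List X) {f : X → ℝ} {c : ℝ} (h : ∀ x, f x ≤ c) :
    Q.Q s f ≤ c :=
  (Q.le_sup s f).trans (ciSup_le h)

theorem Q_le_add (Q : UpperExpTree X) (s : List X) {f g : X → ℝ} {c : ℝ}
    (h : ∀ x, f x ≤ g x + c) : Q.Q s f ≤ Q.Q s g + c := by
  have h1 := Q.subadd s g (f - g)
  rw [add_sub_cancel] at h1
  have h2 : Q.Q s (f - g) ≤ c := Q.Q_le_const s fun x => by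
    have := h x
    simp only [Pi.sub_apply]
    linarith
  linarith

theorem Q_mono (Q : UpperExpTree X) (s : List X) {f g : X → ℝ} (h : ∀ x, f x ≤ g x) :
    Q.Q s f ≤ Q.Q s g := by
  simpa using Q.Q_le_add s (c := 0) (by simpa using h)

theorem exists_le_Q (Q : UpperExpTree X) (s : List X) (f : X → ℝ) : ∃ x, f x ≤ Q.Q s f := by
  obtain ⟨x, hx⟩ := Finite.exists_min f
  refine ⟨x, ?_⟩
  have h0 : Q.Q s 0 = 0 := by simpa using Q.pos_homog s 0 0 le_rfl
  have := Q.Q_le_add s (f := 0) (g := f) (c := -f x) fun y => by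
    have := hx y
    simp only [Pi.zero_apply]
    linarith
  linarith

end UpperExpTree

namespace IsSupermart

variable {Q : UpperExpTree X} {M N : List X → ℝ}

theorem const (c : ℝ) : IsSupermart Q fun _ => c := fun s => Q.Q_le_const s fun _ => le_rfl

theorem add (hM : IsSupermart Q M) (hN : IsSupermart Q N) : IsSupermart Q fun t => M t + N t :=
  fun s => (Q.subadd s (fun x => M (s ++ [x])) fun x => N (s ++ [x])).trans
    (add_le_add (hM s) (hN s))

theorem const_mul (hM : IsSupermart Q M) {c : ℝ} (hc : 0 ≤ c) : IsSupermart Q fun t => c * M t :=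
  fun s => (Q.pos_homog s c (fun x => M (s ++ [x])) hc).le.trans
    (mul_le_mul_of_nonneg_left (hM s) hc)

theorem min (hM : IsSupermart Q M) (hN : IsSupermart Q N) :
    IsSupermart Q fun t => Min.min (M t) (N t) :=
  fun s => le_min ((Q.Q_mono s fun _ => min_le_left _ _).trans (hM s))
    ((Q.Q_mono s fun _ => min_le_right _ _).trans (hN s))

theorem sum {ι : Type*} (A : Finset ι) {F : ι → List X → ℝ} (h : ∀ i, IsSupermart Q (F i)) :
    IsSupermart Q fun t => ∑ i ∈ A, F i t := by
  classical
  induction A using Finset.induction_on with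
  | empty => simpa using const 0
  | insert i A hi ih => simpa [Finset.sum_insert hi] using (h i).add ih

theorem of_tendsto {F : ℕ → List X → ℝ} (hF : ∀ n, IsSupermart Q (F n))
    (h : ∀ t, Tendsto (fun n => F n t) atTop (𝓝 (M t))) : IsSupermart Q M := by
  intro s
  refine le_of_forall_pos_le_add fun ε hε => ?_
  have h1 : ∀ᶠ n in atTop, ∀ x, M (s ++ [x]) - ε / 2 < F n (s ++ [x]) :=
    eventually_all.2 fun x => (h (s ++ [x])).eventually_const_lt (by linarith)
  have h2 : ∀ᶠ n in atTop, F n s < M s + ε / 2 := (h s).eventually_lt_const (by linarith)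
  obtain ⟨n, hn1, hn2⟩ := (h1.and h2).exists
  have h3 := Q.Q_le_add s (f := fun x => M (s ++ [x])) (g := fun x => F n (s ++ [x])) (c := ε / 2)
    fun x => by linarith [hn1 x]
  linarith [hF n s]

/-- Replace a supermartingale by a constant outside the situations extending `s`. -/
theorem restrict (hM : IsSupermart Q M) (s : List X) :
    IsSupermart Q fun t => if s <+: t then M t else M s := by
  intro t
  by_cases ht : s <+: t
  · have h : ∀ x, s <+: t ++ [x] := fun x => ht.trans (List.prefix_append _ _)
    simpa [ht, h] using hM t
  · simp only [ht, if_false]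
    refine Q.Q_le_const t fun x => ?_
    split_ifs with h
    · rcases List.prefix_concat_iff.1 h with h | h
      · exact h ▸ le_rfl
      · exact absurd h ht
    · exact le_rfl

/-- Along some path through `t` a supermartingale never exceeds its value at `t`. -/
theorem exists_path_le (hM : IsSupermart Q M) (t : List X) :
    ∃ ω ∈ cyl t, ∀ k, t.length ≤ k → M (prefixList ω k) ≤ M t := by
  choose next hnext using fun u => Q.exists_le_Q u fun x => M (u ++ [x])
  obtain ⟨ω, hω, h⟩ := exists_path_following next t
  refine ⟨ω, hω, fun k hk => ?_⟩
  induction k, hk using Nat.le_induction with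
  | base => exact le_of_eq (congrArg M hω)
  | succ k hk ih =>
    rw [prefixList_succ, h k hk]
    exact ((hnext _).trans (hM _)).trans ih

end IsSupermart

/-! ### Superhedging prices -/

/-- `M` is a nonnegative supermartingale that eventually dominates `f` along the paths
through `s`. -/
def Superhedge (Q : UpperExpTree X) (f : Path X → ℝ) (s : List X) (M : List X → ℝ) : Prop :=
  IsSupermart Q M ∧ (∀ t, 0 ≤ M t) ∧
    ∀ ω ∈ cyl s, ∀ r < f ω, ∀ᶠ k in atTop, r < M (prefixList ω k)

/-- The least initial capital with which `f` can be superhedged from `s` by a nonnegative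
supermartingale. -/
noncomputable def upVal (Q : UpperExpTree X) (f : Path X → ℝ) (s : List X) : ℝ :=
  sInf ((fun M : List X → ℝ => M s) '' {M | Superhedge Q f s M})

section

variable {Q : UpperExpTree X} {f g : Path X → ℝ} {s t : List X} {M : List X → ℝ} {c : ℝ}

theorem Superhedge.of_prefix (h : Superhedge Q f s M) (hst : s <+: t) : Superhedge Q f t M :=
  ⟨h.1, h.2.1, fun ω hω => h.2.2 ω (cyl_subset_of_prefix hst hω)⟩

theorem Superhedge.of_le (h : Superhedge Q g s M) (hfg : ∀ ω ∈ cyl s, f ω ≤ g ω) :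
    Superhedge Q f s M :=
  ⟨h.1, h.2.1, fun ω hω r hr => h.2.2 ω hω r (hr.trans_le (hfg ω hω))⟩

theorem superhedge_const (hc : 0 ≤ c) (hf : ∀ ω ∈ cyl s, f ω ≤ c) :
    Superhedge Q f s fun _ => c :=
  ⟨IsSupermart.const c, fun _ => hc, fun ω hω _ hr => .of_forall fun _ => hr.trans_le (hf ω hω)⟩

theorem upVal_nonneg (Q : UpperExpTree X) (f : Path X → ℝ) (s : List X) : 0 ≤ upVal Q f s := by
  apply Real.sInf_nonneg
  rintro _ ⟨M, hM, rfl⟩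
  exact hM.2.1 s

theorem Superhedge.upVal_le (h : Superhedge Q f s M) : upVal Q f s ≤ M s := by
  refine csInf_le ⟨0, ?_⟩ ⟨M, h, rfl⟩
  rintro _ ⟨M, hM, rfl⟩
  exact hM.2.1 s

theorem exists_superhedge_lt (hf : ∀ ω, f ω ≤ c) {a : ℝ} (h : upVal Q f s < a) :
    ∃ M, Superhedge Q f s M ∧ M s < a := by
  have hne : ((fun M : List X → ℝ => M s) '' {M | Superhedge Q f s M}).Nonempty :=
    ⟨_, _, superhedge_const (le_max_left 0 c) fun ω _ => (hf ω).trans (le_max_right _ _), rfl⟩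
  obtain ⟨_, ⟨M, hM, rfl⟩, hlt⟩ := exists_lt_of_csInf_lt hne h
  exact ⟨M, hM, hlt⟩

theorem upVal_le_const (hc : 0 ≤ c) (hf : ∀ ω ∈ cyl s, f ω ≤ c) : upVal Q f s ≤ c :=
  (superhedge_const hc hf).upVal_le

theorem upVal_mono (hg : ∀ ω, g ω ≤ c) (hfg : ∀ ω, f ω ≤ g ω) : upVal Q f s ≤ upVal Q g s := by
  refine le_of_forall_gt fun a ha => ?_
  obtain ⟨M, hM, hlt⟩ := exists_superhedge_lt hg ha
  exact (hM.of_le fun ω _ => hfg ω).upVal_le.trans_lt hlt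

theorem isSupermart_upVal (hf : ∀ ω, f ω ≤ c) : IsSupermart Q (upVal Q f) := by
  intro t
  refine le_of_forall_gt fun a ha => ?_
  obtain ⟨M, hM, hlt⟩ := exists_superhedge_lt hf ha
  refine lt_of_le_of_lt (Q.Q_mono t fun x => ?_) ((hM.1 t).trans_lt hlt)
  exact (hM.of_prefix (List.prefix_append _ _)).upVal_le

/-- On bounded nonnegative variables, superhedging with bounded-below supermartingales costs the
same as superhedging with nonnegative ones. -/
theorem gtG_eq_upVal (h0 : ∀ ω, 0 ≤ f ω) (hf : ∀ ω, f ω ≤ c) :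
    gtG Q f s = ((upVal Q f s : ℝ) : EReal) := by
  apply le_antisymm
  · refine le_of_forall_gt fun a ha => ?_
    obtain ⟨r, hr, hra⟩ := EReal.lt_iff_exists_real_btwn.1 ha
    obtain ⟨M, hM, hlt⟩ := exists_superhedge_lt hf (EReal.coe_lt_coe_iff.1 hr)
    refine lt_of_le_of_lt (sInf_le ⟨M, hM.1, ⟨0, hM.2.1⟩, fun ω hω => ?_, rfl⟩)
      ((EReal.coe_lt_coe_iff.2 hlt).trans hra)
    rw [le_liminf_iff]
    intro y hy
    obtain ⟨r', hr', hr''⟩ := EReal.lt_iff_exists_real_btwn.1 hy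
    filter_upwards [hM.2.2 ω hω r' (EReal.coe_lt_coe_iff.1 hr'')] with k hk
    exact hr'.trans (EReal.coe_lt_coe_iff.2 hk)
  · refine le_sInf ?_
    rintro _ ⟨M, hM, -, hlim, rfl⟩
    have hlim' : ∀ ω ∈ cyl s, ∀ r < f ω, ∀ᶠ k in atTop, r < M (prefixList ω k) := by
      intro ω hω r hr
      have h := hlim ω hω
      rw [le_liminf_iff] at h
      simpa only [EReal.coe_lt_coe_iff] using h r (EReal.coe_lt_coe_iff.2 hr)
    have hpos : ∀ t, s <+: t → 0 ≤ M t := by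
      intro t hst
      obtain ⟨ω, hω, hle⟩ := hM.exists_path_le t
      refine le_of_forall_lt fun r hr => ?_
      obtain ⟨k, hk, hk'⟩ := ((hlim' ω (cyl_subset_of_prefix hst hω) r
        (hr.trans_le (h0 ω))).and (eventually_ge_atTop t.length)).exists
      exact hk.trans_le (hle k hk')
    have hsup : Superhedge Q f s fun t => if s <+: t then M t else M s := by
      refine ⟨hM.restrict s, fun t => ?_, fun ω hω r hr => ?_⟩
      · dsimp only
        split_ifs with h
        · exact hpos t h
        · exact hpos s (List.prefix_refl s)
      · filter_upwards [hlim' ω hω r hr, eventually_ge_atTop s.length] with k hk hk'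
        simpa [prefix_prefixList hω hk'] using hk
    simpa using EReal.coe_le_coe_iff.2 hsup.upVal_le

end

section

variable {Q : UpperExpTree X} {f g : Path X → ℝ} {s t : List X} {M : List X → ℝ} {c : ℝ}

/-- Optional switching: follow `M` until the situation enters `S`, and from then on use a
superhedge that is affordable at the time of entry. -/
theorem upVal_le_of_hit (hM : IsSupermart Q M) (h0 : ∀ t, 0 ≤ M t) (S : Set (List X))
    (hS : ∀ u ∈ S, s <+: u ∧ ∃ N, Superhedge Q f u N ∧ N u ≤ M u)
    (hit : ∀ ω ∈ cyl s, 0 < f ω → ∃ k, prefixList ω k ∈ S) : upVal Q f s ≤ M s := by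
  classical
  choose! hs N hN hNle using hS
  let first : List X → Option (List X) := fun t => t.inits.find? (· ∈ S)
  let M' : List X → ℝ := fun t => (first t).elim (M t) fun u => N u t
  have hstep : ∀ t x, first (t ++ [x]) =
      (first t).or (if t ++ [x] ∈ S then some (t ++ [x]) else none) := by
    intro t x
    by_cases h : t ++ [x] ∈ S <;> simp [first, List.inits_append, List.find?_append, h]
  have hfirst : ∀ t u, first t = some u → u ∈ S ∧ u <+: t := by
    intro t u h
    exact ⟨by simpa using List.find?_some h, by simpa using List.mem_of_find?_eq_some h⟩
  have hM'0 : ∀ t, 0 ≤ M' t := by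
    intro t
    cases h : first t with
    | some u => simpa [M', h] using (hN u (hfirst t u h).1).2.1 t
    | none => simpa [M', h] using h0 t
  have hsup : Superhedge Q f s M' := by
    refine ⟨fun t => ?_, hM'0, fun ω hω r hr => ?_⟩
    · cases h : first t with
      | some u => simpa [M', hstep, h] using (hN u (hfirst t u h).1).1 t
      | none =>
        have : ∀ x, M' (t ++ [x]) ≤ M (t ++ [x]) := by
          intro x
          by_cases hx : t ++ [x] ∈ S
          · simpa [M', hstep, h, hx] using hNle _ hx
          · simp [M', hstep, h, hx]
        refine (Q.Q_mono t this).trans ((hM t).trans ?_)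
        simp [M', h]
    · rcases le_or_gt (f ω) 0 with hf | hf
      · exact .of_forall fun k => (hr.trans_le hf).trans_le (hM'0 _)
      · obtain ⟨k, hk⟩ := hit ω hω hf
        obtain ⟨u, hu⟩ : ∃ u, first (prefixList ω k) = some u := by
          rw [← Option.isSome_iff_exists, List.find?_isSome]
          exact ⟨prefixList ω k, by simp, by simpa using hk⟩
        have hstay : ∀ m, k ≤ m → first (prefixList ω m) = some u := by
          intro m hm
          induction m, hm using Nat.le_induction with
          | base => exact hu
          | succ m _ ih => simp [prefixList_succ, hstep, ih]
        obtain ⟨huS, hup⟩ := hfirst _ _ hu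
        filter_upwards [(hN u huS).2.2 ω (cyl_subset_of_prefix hup (mem_cyl_prefixList ω k)) r hr,
          eventually_ge_atTop k] with m hm hkm
        simpa [M', hstay m hkm] using hm
  refine hsup.upVal_le.trans ?_
  cases h : first s with
  | none => simp [M', h]
  | some u =>
    obtain ⟨huS, hup⟩ := hfirst _ _ h
    obtain rfl := hup.eq_of_length (le_antisymm hup.length_le (hs u huS).length_le)
    simpa [M', h] using hNle u huS

/-! ### A game-theoretic zero-one law -/

theorem indicator_one_le (N : Set (Path X)) (ω : Path X) :
    N.indicator (fun _ => (1 : ℝ)) ω ≤ 1 :=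
  Set.indicator_le_self' (fun _ _ => zero_le_one) ω

/-- Paths on which the conditional price of `g` is infinitely often below `a` although `g`
exceeds `b > a` form a null event. -/
theorem upVal_crossing_eq_zero (hg : ∀ ω, g ω ≤ c) {a b : ℝ} (ha : 0 < a) (hab : a < b)
    (t : List X) :
    upVal Q ({ω | b < g ω ∧ ∃ᶠ k in atTop, upVal Q g (prefixList ω k) < a}.indicator
      fun _ => (1 : ℝ)) t = 0 := by
  set N : Set (Path X) := {ω | b < g ω ∧ ∃ᶠ k in atTop, upVal Q g (prefixList ω k) < a}
  set φ : List X → ℝ := upVal Q (N.indicator fun _ => (1 : ℝ))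
  have hb : 0 < b := ha.trans hab
  have hmem : ∀ ω, 0 < N.indicator (fun _ => (1 : ℝ)) ω → ω ∈ N := by
    intro ω h
    by_contra hω
    simp [hω] at h
  have hφ1 : ∀ t, φ t ≤ 1 := fun t => upVal_le_const zero_le_one fun ω _ => indicator_one_le N ω
  have hbdd : BddAbove (Set.range φ) := ⟨1, by rintro _ ⟨t, rfl⟩; exact hφ1 t⟩
  set α : ℝ := ⨆ t, φ t
  have hα : ∀ t, φ t ≤ α := fun t => le_ciSup hbdd t
  have hα0 : 0 ≤ α := (upVal_nonneg _ _ t).trans (hα t)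
  have key : ∀ α', α < α' → ∀ t, φ t ≤ α' * a / b := by
    intro α' hα' t
    have hα'0 : 0 < α' := hα0.trans_lt hα'
    have hdown : ∀ u, upVal Q g u < a → φ u < α' * a / b := by
      intro u hu
      obtain ⟨M, hM, hMa⟩ := exists_superhedge_lt hg hu
      have hc : 0 < α' / b := by positivity
      have h1 : φ u ≤ α' / b * M u := by
        refine upVal_le_of_hit (hM.1.const_mul hc.le) (fun t => mul_nonneg hc.le (hM.2.1 t))
          {v | u <+: v ∧ b < M v} ?_ ?_
        · rintro v ⟨huv, hv⟩
          refine ⟨huv, ?_⟩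
          obtain ⟨M', hM', hlt⟩ := exists_superhedge_lt (indicator_one_le N) ((hα v).trans_lt hα')
          refine ⟨M', hM', hlt.le.trans ?_⟩
          calc α' = α' / b * b := by field_simp
            _ ≤ α' / b * M v := by gcongr
        · intro ω hω hpos
          obtain ⟨k, hk, hk'⟩ := ((hM.2.2 ω hω b (hmem ω hpos).1).and
            (eventually_ge_atTop u.length)).exists
          exact ⟨k, prefix_prefixList hω hk', hk⟩
      calc φ u ≤ α' / b * M u := h1
        _ < α' / b * a := by gcongr
        _ = α' * a / b := by ring
    refine upVal_le_of_hit (M := fun _ => α' * a / b) (IsSupermart.const _)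
      (fun _ => by positivity) {v | t <+: v ∧ upVal Q g v < a} ?_ ?_
    · rintro v ⟨htv, hv⟩
      refine ⟨htv, ?_⟩
      obtain ⟨M', hM', hlt⟩ := exists_superhedge_lt (indicator_one_le N) (hdown v hv)
      exact ⟨M', hM', hlt.le⟩
    · intro ω hω hpos
      obtain ⟨k, hk, hk'⟩ := ((hmem ω hpos).2.and_eventually
        (eventually_ge_atTop t.length)).exists
      exact ⟨k, prefix_prefixList hω hk', hk⟩
  have hle : α ≤ α * (a / b) := by
    refine le_of_forall_gt_imp_ge_of_dense fun y hy => ?_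
    have hab' : 0 < a / b := by positivity
    have := ciSup_le (key (y / (a / b)) ((lt_div_iff₀ hab').2 hy))
    calc α ≤ y / (a / b) * a / b := this
      _ = y := by field_simp
  have h1 : a / b < 1 := (div_lt_one hb).2 hab
  refine le_antisymm ((hα t).trans ?_) (upVal_nonneg _ _ t)
  nlinarith

theorem exists_superhedge_iUnion {N : ℕ → Set (Path X)}
    (h : ∀ n, upVal Q ((N n).indicator fun _ => (1 : ℝ)) s = 0) {ε : ℝ} (hε : 0 < ε) :
    ∃ T, Superhedge Q ((⋃ n, N n).indicator fun _ => (1 : ℝ)) s T ∧ T s ≤ ε := by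
  have hpos : ∀ n : ℕ, 0 < ε / 2 / 2 ^ n := fun n => by positivity
  choose T hT hTs using fun n => exists_superhedge_lt (indicator_one_le (N n))
    ((h n).trans_lt (hpos n))
  let F : ℕ → List X → ℝ := fun K t => min (∑ n ∈ Finset.range K, T n t) 1
  have hF : ∀ K, IsSupermart Q (F K) := fun K =>
    (IsSupermart.sum _ fun n => (hT n).1).min (IsSupermart.const 1)
  have hmono : ∀ t, Monotone fun K => F K t := by
    intro t K L hKL
    exact min_le_min_right _ (Finset.sum_le_sum_of_subset_of_nonneg
      (Finset.range_mono hKL) fun n _ _ => (hT n).2.1 t)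
  have hbdd : ∀ t, BddAbove (Set.range fun K => F K t) := by
    intro t
    refine ⟨1, ?_⟩
    rintro _ ⟨K, rfl⟩
    exact min_le_right _ _
  have hlim : ∀ t, Tendsto (fun K => F K t) atTop (𝓝 (⨆ K, F K t)) := fun t =>
    tendsto_atTop_ciSup (hmono t) (hbdd t)
  have hle : ∀ K t, F K t ≤ ⨆ K, F K t := fun K t => le_ciSup (hbdd t) K
  have h0 : ∀ t, 0 ≤ ⨆ K, F K t := fun t => le_trans (by simp [F]) (hle 0 t)
  refine ⟨fun t => ⨆ K, F K t, ⟨IsSupermart.of_tendsto hF hlim, h0, fun ω hω r hr => ?_⟩,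
    ciSup_le fun K => (min_le_left _ _).trans ?_⟩
  · by_cases hN : ω ∈ ⋃ n, N n
    · obtain ⟨n, hn⟩ := Set.mem_iUnion.1 hN
      rw [Set.indicator_of_mem hN] at hr
      have hr' : r < (N n).indicator (fun _ => (1 : ℝ)) ω := by rwa [Set.indicator_of_mem hn]
      filter_upwards [(hT n).2.2 ω hω r hr'] with k hk
      refine lt_of_lt_of_le (lt_min ?_ hr) (hle (n + 1) _)
      refine hk.trans_le (Finset.single_le_sum (f := fun n => T n (prefixList ω k))
        (fun i _ => (hT i).2.1 _) (by simp))
    · rw [Set.indicator_of_notMem hN] at hr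
      exact .of_forall fun k => hr.trans_le (h0 _)
  · calc ∑ n ∈ Finset.range K, T n s ≤ ∑ n ∈ Finset.range K, ε / 2 / 2 ^ n :=
        Finset.sum_le_sum fun n _ => (hTs n).le
      _ ≤ ∑' n : ℕ, ε / 2 / 2 ^ n :=
        (summable_geometric_two' ε).sum_le_tsum _ fun n _ => (hpos n).le
      _ = ε := tsum_geometric_two' ε

/-- Superhedging prices are continuous along bounded nondecreasing sequences. -/
theorem upVal_le_iSup {fn : ℕ → Path X → ℝ} (hmono : Monotone fn)
    (hc : ∀ n ω, fn n ω ≤ c) (hfc : ∀ ω, f ω ≤ c)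
    (hf : ∀ ω, ∀ r < f ω, ∃ n, r < fn n ω) (hc0 : 0 < c) (s : List X) :
    upVal Q f s ≤ ⨆ n, upVal Q (fn n) s := by
  have hbdd : ∀ t, BddAbove (Set.range fun n => upVal Q (fn n) t) := by
    intro t
    refine ⟨c, ?_⟩
    rintro _ ⟨n, rfl⟩
    exact upVal_le_const hc0.le fun ω _ => hc n ω
  have hle : ∀ n t, upVal Q (fn n) t ≤ ⨆ n, upVal Q (fn n) t := fun n t => le_ciSup (hbdd t) n
  have hE : IsSupermart Q fun t => ⨆ n, upVal Q (fn n) t :=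
    IsSupermart.of_tendsto (fun n => isSupermart_upVal (hc n)) fun t =>
      tendsto_atTop_ciSup (fun m n hmn => upVal_mono (hc n) (hmono hmn)) (hbdd t)
  have hE0 : ∀ t, 0 ≤ ⨆ n, upVal Q (fn n) t := fun t => (upVal_nonneg _ _ t).trans (hle 0 t)
  obtain ⟨e, he⟩ := exists_surjective_nat (ℕ × {q : ℚ × ℚ // 0 < q.1 ∧ q.1 < q.2} ⊕ Unit)
  let N : ℕ × {q : ℚ × ℚ // 0 < q.1 ∧ q.1 < q.2} ⊕ Unit → Set (Path X) := Sum.elim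
    (fun i => {ω | (i.2.1.2 : ℝ) < fn i.1 ω ∧
      ∃ᶠ k in atTop, upVal Q (fn i.1) (prefixList ω k) < (i.2.1.1 : ℝ)}) fun _ => ∅
  have hN : ∀ i, upVal Q ((N i).indicator fun _ => (1 : ℝ)) s = 0 := by
    rintro (⟨n, ⟨⟨a, b⟩, ha, hab⟩⟩ | _)
    · exact upVal_crossing_eq_zero (hc n) (by exact_mod_cast ha) (by exact_mod_cast hab) s
    · exact le_antisymm (upVal_le_const le_rfl (by simp [N])) (upVal_nonneg _ _ _)
  refine le_of_forall_pos_le_add fun ε hε => ?_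
  obtain ⟨T, hT, hTs⟩ := exists_superhedge_iUnion (fun n => hN (e n)) (div_pos hε hc0)
  have hT0 : ∀ t, 0 ≤ c * T t := fun t => mul_nonneg hc0.le (hT.2.1 t)
  have hsup : Superhedge Q f s fun t => (⨆ n, upVal Q (fn n) t) + c * T t := by
    refine ⟨hE.add (hT.1.const_mul hc0.le), fun t => add_nonneg (hE0 t) (hT0 t),
      fun ω hω r hr => ?_⟩
    by_cases hmem : ω ∈ ⋃ n, N (e n)
    · have hrc : r / c < (⋃ n, N (e n)).indicator (fun _ => (1 : ℝ)) ω := by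
        rw [Set.indicator_of_mem hmem, div_lt_one hc0]
        exact hr.trans_le (hfc ω)
      filter_upwards [hT.2.2 ω hω _ hrc] with k hk
      rw [div_lt_iff₀' hc0] at hk
      linarith [hE0 (prefixList ω k)]
    · rcases lt_or_ge r 0 with hr0 | hr0
      · exact .of_forall fun k => hr0.trans_le (add_nonneg (hE0 _) (hT0 _))
      · obtain ⟨n, hn⟩ := hf ω r hr
        obtain ⟨b, hrb, hbn⟩ := exists_rat_btwn hn
        obtain ⟨a, hra, hab⟩ := exists_rat_btwn hrb
        have ha0 : (0 : ℚ) < a := by exact_mod_cast hr0.trans_lt hra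
        have hab' : a < b := by exact_mod_cast hab
        have hnot : ω ∉ N (Sum.inl (n, ⟨(a, b), ha0, hab'⟩)) := by
          obtain ⟨m, hm⟩ := he (Sum.inl (n, ⟨(a, b), ha0, hab'⟩))
          rw [← hm]
          exact fun h => hmem (Set.mem_iUnion.2 ⟨m, h⟩)
        have hev : ∀ᶠ k in atTop, (a : ℝ) ≤ upVal Q (fn n) (prefixList ω k) := by
          by_contra hcon
          refine hnot ⟨hbn, ?_⟩
          simpa only [not_eventually, not_le] using hcon
        filter_upwards [hev] with k hk
        linarith [hle n (prefixList ω k), hT0 (prefixList ω k)]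
  refine hsup.upVal_le.trans ?_
  have : c * T s ≤ ε := by rwa [le_div_iff₀' hc0] at hTs
  linarith

end

/-! ### Topology of the path space -/

section

variable [TopologicalSpace X] [DiscreteTopology X]

theorem isOpen_of_prefixList {A : Set (Path X)} (n : ℕ)
    (h : ∀ ω ω', prefixList ω n = prefixList ω' n → ω ∈ A → ω' ∈ A) : IsOpen A := by
  refine isOpen_iff_forall_mem_open.2 fun ω hω => ⟨PiNat.cylinder ω n, fun ω' hω' => ?_,
    PiNat.isOpen_cylinder _ ω n, PiNat.self_mem_cylinder ω n⟩
  refine h ω ω' ((prefixList_eq_iff _ _ _).2 fun i hi => ?_) hω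
  exact (PiNat.mem_cylinder_iff.1 hω' i hi).symm

theorem exists_cyl_subset_of_isOpen {A : Set (Path X)} (hA : IsOpen A) {ω : Path X} (hω : ω ∈ A) :
    ∃ n, ∀ m, n ≤ m → cyl (prefixList ω m) ⊆ A := by
  obtain ⟨_, ⟨ω₀, n, rfl⟩, h1, h2⟩ :=
    (PiNat.isTopologicalBasis_cylinders fun _ => X).mem_nhds_iff.1 (hA.mem_nhds hω)
  refine ⟨n, fun m hm ω' hω' => h2 ?_⟩
  have hω' : prefixList ω' m = prefixList ω m := by simpa [cyl] using hω'
  rw [prefixList_eq_iff] at hω'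
  rw [PiNat.mem_cylinder_iff] at h1 ⊢
  exact fun i hi => (hω' i (hi.trans_le hm)).trans (h1 i hi)

/-- A sequence of functions, the `n`-th of which depends only on the first `n` states, can be
superhedged at the price of its nonincreasing limit. -/
theorem exists_upVal_le_add {Q : UpperExpTree X} {f : Path X → ℝ} {h : ℕ → Path X → ℝ} {c : ℝ}
    (hanti : Antitone h) (hmeas : ∀ n ω ω', prefixList ω n = prefixList ω' n → h n ω = h n ω')
    (hfc : ∀ ω, f ω ≤ c) (hlim : ∀ ω, ∀ r > f ω, ∃ n, h n ω < r) (s : List X)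
    {ε : ℝ} (hε : 0 < ε) : ∃ n, upVal Q (h n) s ≤ upVal Q f s + ε := by
  obtain ⟨M, hM, hMs⟩ := exists_superhedge_lt (s := s) (Q := Q) hfc
    (show upVal Q f s < upVal Q f s + ε / 2 by linarith)
  let U : ℕ → Set (Path X) := fun m => {ω | ω ∈ cyl s →
    h (m + s.length) ω < M (prefixList ω (m + s.length)) + ε / 2}
  have hU : ∀ m, IsOpen (U m) := by
    refine fun m => isOpen_of_prefixList (m + s.length) fun ω ω' heq hω hω' => ?_
    have hs : ω ∈ cyl s := by
      refine Eq.trans ((prefixList_eq_iff _ _ _).2 fun i hi => ?_) hω'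
      exact (prefixList_eq_iff _ _ _).1 heq i (by omega)
    have := hω hs
    rwa [hmeas _ _ _ heq, heq] at this
  have hcover : Set.univ ⊆ ⋃ m, U m := by
    intro ω _
    by_cases hω : ω ∈ cyl s
    · obtain ⟨n, hn⟩ := hlim ω (f ω + ε / 4) (by linarith)
      obtain ⟨k, hk, hk'⟩ := ((hM.2.2 ω hω (f ω - ε / 4) (by linarith)).and
        (eventually_ge_atTop (n + s.length))).exists
      refine Set.mem_iUnion.2 ⟨k - s.length, fun _ => ?_⟩
      rw [Nat.sub_add_cancel (by omega)]
      have : h k ω ≤ h n ω := hanti (by omega) ω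
      linarith
    · exact Set.mem_iUnion.2 ⟨0, fun h => absurd h hω⟩
  obtain ⟨A, hA⟩ := isCompact_univ.elim_finite_subcover U hU hcover
  let K : ℕ := A.sup id + s.length
  refine ⟨K, ?_⟩
  have hpos : ∀ t, 0 ≤ M t + ε / 2 := fun t => add_nonneg (hM.2.1 t) (by linarith)
  have hle := upVal_le_of_hit (f := h K) (s := s) (hM.1.add (IsSupermart.const (ε / 2))) hpos
    {u | s <+: u ∧ u.length ≤ K ∧ ∀ ω ∈ cyl u, h u.length ω < M u + ε / 2} ?_ ?_
  · linarith
  · rintro u ⟨hsu, huK, hu⟩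
    exact ⟨hsu, _, superhedge_const (hpos u) fun ω hω =>
      (hanti huK ω).trans (hu ω hω).le, le_rfl⟩
  · intro ω hω _
    obtain ⟨m, hm, hmU⟩ := Set.mem_iUnion₂.1 (hA (Set.mem_univ ω))
    refine ⟨m + s.length, prefix_prefixList hω (by omega), ?_, ?_⟩
    · simpa [K] using Finset.le_sup (f := id) hm
    · intro ω' hω'
      simp only [length_prefixList]
      have hω' : prefixList ω' (m + s.length) = prefixList ω (m + s.length) := by
        simpa [cyl] using hω'
      rw [hmeas _ _ _ hω']
      exact hmU hω

/-- Continuity along nonincreasing sequences of upper semicontinuous functions reduces to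
sequences whose `n`-th member depends only on the first `n` states. -/
theorem tendsto_of_antitone_usc {F : (Path X → EReal) → EReal}
    (hF : ∀ f g : Path X → EReal, (∀ ω, 0 ≤ f ω) → (∀ ω, 0 ≤ g ω) → (∀ ω, f ω ≤ g ω) → F f ≤ F g)
    (hfin : ∀ (c : ℝ) (h : ℕ → Path X → ℝ) (g : Path X → ℝ), (∀ n ω, h n ω ≤ c) → Antitone h →
      (∀ n ω ω', prefixList ω n = prefixList ω' n → h n ω = h n ω') → (∀ ω, 0 ≤ g ω) →
      (∀ n ω, g ω ≤ h n ω) → (∀ ω, ∀ r > g ω, ∃ n, h n ω < r) →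
      ⨅ n, F (fun ω => (h n ω : EReal)) ≤ F fun ω => (g ω : EReal))
    {fn : ℕ → Path X → EReal} (hfn : ∀ n ω, 0 ≤ fn n ω ∧ fn n ω < ⊤) (husc : ∀ n, USC (fn n))
    (hanti : Antitone fn) :
    Tendsto (fun n => F (fn n)) atTop (𝓝 (F fun ω => ⨅ n, fn n ω)) := by
  let u : ℕ → Path X → ℝ := fun n ω => (fn n ω).toReal
  have hu : ∀ n ω, ((u n ω : ℝ) : EReal) = fn n ω := fun n ω =>
    EReal.coe_toReal (hfn n ω).2.ne (EReal.bot_lt_zero.trans_le (hfn n ω).1).ne'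
  have hu0 : ∀ n ω, 0 ≤ u n ω := fun n ω => EReal.toReal_nonneg (hfn n ω).1
  have huanti : ∀ {m n}, m ≤ n → ∀ ω, u n ω ≤ u m ω := fun hmn ω => by
    rw [← EReal.coe_le_coe_iff, hu, hu]
    exact hanti hmn ω
  have hopen : ∀ n (a : ℝ), IsOpen {ω | u n ω < a} := fun n a => by
    simpa only [← hu, EReal.coe_lt_coe_iff] using husc n a
  obtain ⟨A, hA⟩ := isCompact_univ.elim_finite_subcover (fun k : ℕ => {ω | u 0 ω < k})
    (fun k => hopen 0 k) fun ω _ => Set.mem_iUnion.2 (exists_nat_gt (u 0 ω))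
  have huc : ∀ n ω, u n ω ≤ (A.sup id : ℕ) := by
    intro n ω
    obtain ⟨k, hk, hkω⟩ := Set.mem_iUnion₂.1 (hA (Set.mem_univ ω))
    have h1 : k ≤ A.sup id := Finset.le_sup (f := id) hk
    have h2 : (k : ℝ) ≤ (A.sup id : ℕ) := by exact_mod_cast h1
    exact (huanti (Nat.zero_le n) ω).trans (le_trans (le_of_lt hkω) h2)
  set c : ℝ := ((A.sup id : ℕ) : ℝ)
  let h : ℕ → Path X → ℝ := fun n ω => sSup (u n '' cyl (prefixList ω n))
  have hbdd : ∀ n (B : Set (Path X)), BddAbove (u n '' B) := by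
    refine fun n B => ⟨c, ?_⟩
    rintro _ ⟨ω, -, rfl⟩
    exact huc n ω
  have huh : ∀ n ω, u n ω ≤ h n ω := fun n ω =>
    le_csSup (hbdd n _) ⟨ω, mem_cyl_prefixList ω n, rfl⟩
  have hhle : ∀ n ω (a : ℝ), (∀ ω' ∈ cyl (prefixList ω n), u n ω' ≤ a) → h n ω ≤ a := by
    intro n ω a ha
    refine csSup_le ((cyl_nonempty _).image _) ?_
    rintro _ ⟨ω', hω', rfl⟩
    exact ha ω' hω'
  let g : Path X → ℝ := fun ω => ⨅ n, u n ω
  have hgbdd : ∀ ω, BddBelow (Set.range fun n => u n ω) := by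
    refine fun ω => ⟨0, ?_⟩
    rintro _ ⟨n, rfl⟩
    exact hu0 n ω
  have hg : (fun ω => ⨅ n, fn n ω) = fun ω => (g ω : EReal) := by
    funext ω
    apply le_antisymm
    · refine le_of_forall_gt fun a ha => ?_
      obtain ⟨r, hr, hra⟩ := EReal.lt_iff_exists_real_btwn.1 ha
      obtain ⟨n, hn⟩ := exists_lt_of_ciInf_lt (EReal.coe_lt_coe_iff.1 hr)
      refine (iInf_le _ n).trans_lt (lt_trans ?_ hra)
      rw [← hu]
      exact EReal.coe_lt_coe_iff.2 hn
    · refine le_iInf fun n => ?_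
      rw [← hu]
      exact EReal.coe_le_coe_iff.2 (ciInf_le (hgbdd ω) n)
  have hlim : Tendsto (fun n => F (fn n)) atTop (𝓝 (⨅ n, F (fn n))) :=
    tendsto_atTop_iInf fun m n hmn => hF _ _ (fun ω => (hfn _ ω).1) (fun ω => (hfn _ ω).1)
      (hanti hmn)
  convert hlim using 2
  apply le_antisymm
  · exact le_iInf fun n => hF _ _ (fun ω => le_iInf fun n => (hfn n ω).1) (fun ω => (hfn _ ω).1)
      fun ω => iInf_le _ n
  · rw [hg]
    refine le_trans (iInf_mono fun n => ?_) (hfin c h g ?_ ?_ ?_ ?_ ?_ ?_)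
    · refine hF _ _ (fun ω => (hfn _ ω).1) (fun ω => ?_) fun ω => ?_
      · exact EReal.coe_nonneg.2 ((hu0 n ω).trans (huh n ω))
      · rw [← hu]
        exact EReal.coe_le_coe_iff.2 (huh n ω)
    · exact fun n ω => hhle n ω c fun ω' _ => huc n ω'
    · intro m n hmn ω
      refine hhle n ω _ fun ω' hω' => (huanti hmn ω').trans (le_csSup (hbdd m _) ⟨ω', ?_, rfl⟩)
      exact cyl_subset_of_prefix (prefixList_prefix ω hmn) hω'
    · intro n ω ω' heq
      simp only [h, heq]
    · exact fun ω => le_ciInf fun n => hu0 n ω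
    · exact fun n ω => (ciInf_le (hgbdd ω) n).trans (huh n ω)
    · intro ω r hr
      obtain ⟨q, hq, hqr⟩ := exists_between hr
      obtain ⟨m, hm⟩ := exists_lt_of_ciInf_lt hq
      obtain ⟨k, hk⟩ := exists_cyl_subset_of_isOpen (hopen m q) (ω := ω) hm
      refine ⟨max m k, lt_of_le_of_lt (hhle _ ω q fun ω' hω' => ?_) hqr⟩
      exact (huanti (le_max_left m k) ω').trans (hk _ (le_max_right m k) hω').le

end

/-! ### The game-theoretic upper expectation -/

/-- The truncation of a variable at level `n`. -/
noncomputable def cut (f : Path X → EReal) (n : ℕ) : Path X → ℝ :=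
  fun ω => (f ω ⊓ ((n : ℝ) : EReal)).toReal

theorem coe_cut {f : Path X → EReal} (hf : ∀ ω, 0 ≤ f ω) (n : ℕ) (ω : Path X) :
    ((cut f n ω : ℝ) : EReal) = f ω ⊓ ((n : ℝ) : EReal) := by
  refine EReal.coe_toReal (ne_top_of_le_ne_top (EReal.coe_ne_top _) inf_le_right) ?_
  refine (EReal.bot_lt_zero.trans_le (le_inf (hf ω) ?_)).ne'
  exact EReal.coe_nonneg.2 n.cast_nonneg

theorem cut_nonneg {f : Path X → EReal} (hf : ∀ ω, 0 ≤ f ω) (n : ℕ) (ω : Path X) :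
    0 ≤ cut f n ω :=
  EReal.toReal_nonneg (le_inf (hf ω) (EReal.coe_nonneg.2 n.cast_nonneg))

theorem cut_le {f : Path X → EReal} (hf : ∀ ω, 0 ≤ f ω) (n : ℕ) (ω : Path X) :
    cut f n ω ≤ n := by
  rw [← EReal.coe_le_coe_iff, coe_cut hf]
  exact inf_le_right

theorem cut_mono {f g : Path X → EReal} (hf : ∀ ω, 0 ≤ f ω) (hfg : ∀ ω, f ω ≤ g ω)
    (n : ℕ) (ω : Path X) : cut f n ω ≤ cut g n ω := by
  rw [← EReal.coe_le_coe_iff, coe_cut hf, coe_cut fun ω => (hf ω).trans (hfg ω)]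
  exact inf_le_inf_right _ (hfg ω)

theorem gtG_mono {Q : UpperExpTree X} {f g : Path X → ℝ} (h : ∀ ω, f ω ≤ g ω) (s : List X) :
    gtG Q f s ≤ gtG Q g s := by
  refine sInf_le_sInf ?_
  rintro _ ⟨M, hM, hB, hlim, rfl⟩
  exact ⟨M, hM, hB, fun ω hω => (EReal.coe_le_coe_iff.2 (h ω)).trans (hlim ω hω), rfl⟩

theorem gtBB_mono {Q : UpperExpTree X} {f g : Path X → EReal} (hf : ∀ ω, 0 ≤ f ω)
    (hfg : ∀ ω, f ω ≤ g ω) (s : List X) : gtBB Q f s ≤ gtBB Q g s := by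
  refine iSup_mono fun c => gtG_mono (fun ω => ?_) s
  refine EReal.toReal_le_toReal (inf_le_inf_right _ (hfg ω)) ?_
    (ne_top_of_le_ne_top (EReal.coe_ne_top c) inf_le_right)
  exact (lt_inf_iff.2 ⟨EReal.bot_lt_zero.trans_le (hf ω), EReal.bot_lt_coe c⟩).ne'

theorem gtUE_eq_iSup (Q : UpperExpTree X) {f : Path X → EReal} (hf : ∀ ω, 0 ≤ f ω) (s : List X) :
    gtUE Q f s = ⨆ n : ℕ, ((upVal Q (cut f n) s : ℝ) : EReal) := by
  have h1 : gtUE Q f s = gtBB Q f s := by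
    apply le_antisymm
    · refine (iInf_le _ 0).trans_eq ?_
      congr 1
      funext ω
      exact sup_eq_left.2 (hf ω)
    · exact le_iInf fun c => gtBB_mono hf (fun ω => le_sup_left) s
  have h2 : ∀ n, gtG Q (cut f n) s = ((upVal Q (cut f n) s : ℝ) : EReal) := fun n =>
    gtG_eq_upVal (cut_nonneg hf n) (cut_le hf n)
  rw [h1]
  apply le_antisymm
  · refine iSup_le fun c => ?_
    obtain ⟨n, hn⟩ := exists_nat_ge c
    refine le_trans (gtG_mono (fun ω => ?_) s) ((h2 n).le.trans (le_iSup
      (fun n : ℕ => ((upVal Q (cut f n) s : ℝ) : EReal)) n))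
    refine EReal.toReal_le_toReal (inf_le_inf_left _ (EReal.coe_le_coe_iff.2 hn)) ?_
      (ne_top_of_le_ne_top (EReal.coe_ne_top n) inf_le_right)
    exact (lt_inf_iff.2 ⟨EReal.bot_lt_zero.trans_le (hf ω), EReal.bot_lt_coe c⟩).ne'
  · exact iSup_le fun n => (h2 n).ge.trans (le_iSup
      (fun c : ℝ => gtG Q (fun ω => (f ω ⊓ (c : EReal)).toReal) s) (n : ℝ))

theorem gtUE_nonneg (Q : UpperExpTree X) {f : Path X → EReal} (hf : ∀ ω, 0 ≤ f ω) (s : List X) :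
    0 ≤ gtUE Q f s := by
  rw [gtUE_eq_iSup Q hf]
  exact (EReal.coe_nonneg.2 (upVal_nonneg Q (cut f 0) s)).trans
    (le_iSup (fun n : ℕ => ((upVal Q (cut f n) s : ℝ) : EReal)) 0)

theorem gtUE_mono (Q : UpperExpTree X) {f g : Path X → EReal} (hf : ∀ ω, 0 ≤ f ω)
    (hfg : ∀ ω, f ω ≤ g ω) (s : List X) : gtUE Q f s ≤ gtUE Q g s := by
  have hg : ∀ ω, 0 ≤ g ω := fun ω => (hf ω).trans (hfg ω)
  rw [gtUE_eq_iSup Q hf, gtUE_eq_iSup Q hg]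
  exact iSup_mono fun n => EReal.coe_le_coe_iff.2 (upVal_mono (cut_le hg n) (cut_mono hf hfg n))

theorem gtUE_coe (Q : UpperExpTree X) {f : Path X → ℝ} {c : ℝ} (hf : ∀ ω, 0 ≤ f ω)
    (hc : ∀ ω, f ω ≤ c) (s : List X) :
    gtUE Q (fun ω => (f ω : EReal)) s = ((upVal Q f s : ℝ) : EReal) := by
  have hf' : ∀ ω, 0 ≤ (f ω : EReal) := fun ω => EReal.coe_nonneg.2 (hf ω)
  rw [gtUE_eq_iSup Q hf']
  apply le_antisymm
  · refine iSup_le fun n => EReal.coe_le_coe_iff.2 (upVal_mono hc fun ω => ?_)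
    rw [← EReal.coe_le_coe_iff, coe_cut hf']
    exact inf_le_left
  · obtain ⟨n, hn⟩ := exists_nat_ge c
    refine le_trans (le_of_eq ?_) (le_iSup
      (fun n : ℕ => ((upVal Q (cut (fun ω => (f ω : EReal)) n) s : ℝ) : EReal)) n)
    congr 2
    funext ω
    rw [← EReal.coe_eq_coe_iff, coe_cut hf']
    exact (inf_eq_left.2 (EReal.coe_le_coe_iff.2 ((hc ω).trans hn))).symm

theorem gtUE_iSup (Q : UpperExpTree X) {fn : ℕ → Path X → EReal} (h0 : ∀ n ω, 0 ≤ fn n ω)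
    (hmono : Monotone fn) (s : List X) :
    gtUE Q (fun ω => ⨆ n, fn n ω) s = ⨆ n, gtUE Q (fn n) s := by
  have hle : ∀ n ω, fn n ω ≤ ⨆ n, fn n ω := fun n ω => le_iSup (fun n => fn n ω) n
  have h0' : ∀ ω, 0 ≤ ⨆ n, fn n ω := fun ω => (h0 0 ω).trans (hle 0 ω)
  apply le_antisymm
  · rw [gtUE_eq_iSup Q h0']
    refine iSup_le fun k => ?_
    have hc0 : (0 : ℝ) < k + 1 := by positivity
    have hk : (k : ℝ) ≤ k + 1 := by linarith
    have key := upVal_le_iSup (Q := Q) (f := cut (fun ω => ⨆ n, fn n ω) k)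
      (fn := fun n => cut (fn n) k) (fun m n hmn => cut_mono (h0 m) (hmono hmn) k)
      (fun n ω => (cut_le (h0 n) k ω).trans hk) (fun ω => (cut_le h0' k ω).trans hk) ?_ hc0 s
    · refine le_of_forall_lt fun a ha => ?_
      obtain ⟨r, har, hr⟩ := EReal.lt_iff_exists_real_btwn.1 ha
      obtain ⟨n, hn⟩ := exists_lt_of_lt_ciSup ((EReal.coe_lt_coe_iff.1 hr).trans_le key)
      refine (har.trans (EReal.coe_lt_coe_iff.2 hn)).trans_le (le_trans ?_ (le_iSup _ n))
      rw [gtUE_eq_iSup Q (h0 n)]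
      exact le_iSup (fun k : ℕ => ((upVal Q (cut (fn n) k) s : ℝ) : EReal)) k
    · intro ω r hr
      rw [← EReal.coe_lt_coe_iff, coe_cut h0', lt_inf_iff, lt_iSup_iff] at hr
      obtain ⟨⟨n, hn⟩, hk⟩ := hr
      refine ⟨n, ?_⟩
      rw [← EReal.coe_lt_coe_iff, coe_cut (h0 n)]
      exact lt_inf_iff.2 ⟨hn, hk⟩
  · exact iSup_le fun n => gtUE_mono Q (h0 n) (hle n) s

theorem isCapacity_gtUE [TopologicalSpace X] [DiscreteTopology X] (Q : UpperExpTree X)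
    (s : List X) : IsCapacity fun f => gtUE Q f s := by
  refine ⟨fun f hf => gtUE_nonneg Q hf s, fun f g hf _ hfg => gtUE_mono Q hf hfg s,
    fun fn h0 hmono => ?_, fun fn hfn husc hanti => ?_⟩
  · dsimp only
    rw [gtUE_iSup Q h0 hmono]
    exact tendsto_atTop_iSup fun m n hmn => gtUE_mono Q (h0 m) (hmono hmn) s
  · refine tendsto_of_antitone_usc (F := fun f => gtUE Q f s)
      (fun f g hf _ hfg => gtUE_mono Q hf hfg s) ?_ hfn husc hanti
    intro c h g hc hh hmeas hg0 hgh hlim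
    have hgc : ∀ ω, g ω ≤ c := fun ω => (hgh 0 ω).trans (hc 0 ω)
    rw [gtUE_coe Q hg0 hgc]
    refine le_of_forall_gt fun a ha => ?_
    obtain ⟨r, hr, hra⟩ := EReal.lt_iff_exists_real_btwn.1 ha
    obtain ⟨n, hn⟩ := exists_upVal_le_add (Q := Q) hh hmeas hgc hlim s
      (sub_pos.2 (EReal.coe_lt_coe_iff.1 hr))
    refine (iInf_le _ n).trans_lt (lt_of_le_of_lt ?_ hra)
    rw [gtUE_coe Q (fun ω => (hg0 ω).trans (hgh n ω)) (hc n)]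
    exact EReal.coe_le_coe_iff.2 (by linarith)

/-! ### The measure-theoretic upper expectation -/

section

variable {μ : Measure (Path X)} {f g : Path X → EReal}

theorem posPart_eq_toENNReal (x : EReal) : posPart x = x.toENNReal := rfl

theorem integralE_of_nonneg (hg : ∀ ω, 0 ≤ g ω) :
    integralE μ g = ((∫⁻ ω, (g ω).toENNReal ∂μ : ℝ≥0∞) : EReal) := by
  have h : ∀ ω, (-(g ω)).toENNReal = 0 := fun ω =>
    EReal.toENNReal_of_nonpos (EReal.neg_le_zero.2 (hg ω))
  simp [integralE, posPart_eq_toENNReal, h]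

theorem le_coe_of_toENNReal_le {x : EReal} {y : ℝ≥0∞} (h : x.toENNReal ≤ y) : x ≤ (y : EReal) :=
  calc x ≤ max 0 x := le_max_right _ _
    _ = (x.toENNReal : EReal) := EReal.coe_toENNReal_eq_max.symm
    _ ≤ y := EReal.coe_ennreal_le_coe_ennreal_iff.2 h

theorem upperInt_le_lintegral {φ : Path X → ℝ≥0∞} (hφ : Measurable φ)
    (hf : ∀ ω, (f ω).toENNReal ≤ φ ω) : upperInt μ f ≤ ((∫⁻ ω, φ ω ∂μ : ℝ≥0∞) : EReal) := by
  refine sInf_le ⟨fun ω => (φ ω : EReal), hφ.coe_ereal_ennreal,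
    ⟨0, fun ω => EReal.coe_ennreal_nonneg _⟩, fun ω => le_coe_of_toENNReal_le (hf ω), ?_⟩
  rw [integralE_of_nonneg fun ω => EReal.coe_ennreal_nonneg _]
  simp

theorem exists_lintegral_lt_of_upperInt_lt (hf : ∀ ω, 0 ≤ f ω) {a : EReal} (h : upperInt μ f < a) :
    ∃ φ : Path X → ℝ≥0∞, Measurable φ ∧ (∀ ω, (f ω).toENNReal ≤ φ ω) ∧
      ((∫⁻ ω, φ ω ∂μ : ℝ≥0∞) : EReal) < a := by
  obtain ⟨_, ⟨g, hg, -, hfg, rfl⟩, hlt⟩ := sInf_lt_iff.1 h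
  rw [integralE_of_nonneg fun ω => (hf ω).trans (hfg ω)] at hlt
  exact ⟨_, hg.ereal_toENNReal, fun ω => EReal.toENNReal_le_toENNReal (hfg ω), hlt⟩

theorem lintegral_le_upperInt (hf : ∀ ω, 0 ≤ f ω) :
    ((∫⁻ ω, (f ω).toENNReal ∂μ : ℝ≥0∞) : EReal) ≤ upperInt μ f := by
  refine le_of_forall_gt fun a ha => ?_
  obtain ⟨φ, -, hφ, hlt⟩ := exists_lintegral_lt_of_upperInt_lt hf ha
  exact lt_of_le_of_lt (EReal.coe_ennreal_le_coe_ennreal_iff.2 (lintegral_mono hφ)) hlt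

theorem upperInt_mono (hfg : ∀ ω, f ω ≤ g ω) : upperInt μ f ≤ upperInt μ g := by
  refine sInf_le_sInf ?_
  rintro _ ⟨φ, hφ, hB, hgφ, rfl⟩
  exact ⟨φ, hφ, hB, fun ω => (hfg ω).trans (hgφ ω), rfl⟩

theorem upperInt_iSup_le {fn : ℕ → Path X → EReal} (h0 : ∀ n ω, 0 ≤ fn n ω)
    (hmono : Monotone fn) : upperInt μ (fun ω => ⨆ n, fn n ω) ≤ ⨆ n, upperInt μ (fn n) := by
  refine le_of_forall_gt fun b hb => ?_
  obtain ⟨a, ha, hab⟩ := exists_between hb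
  choose φ hφ hfφ hφa using fun n => exists_lintegral_lt_of_upperInt_lt (h0 n)
    ((le_iSup (fun n => upperInt μ (fn n)) n).trans_lt ha)
  let ψ : ℕ → Path X → ℝ≥0∞ := fun n ω => ⨅ m, φ (n + m) ω
  have hψ : ∀ n, Measurable (ψ n) := fun n => Measurable.iInf fun m => hφ (n + m)
  have hψmono : Monotone ψ := by
    refine monotone_nat_of_le_succ fun n ω => le_iInf fun m => (iInf_le _ (m + 1)).trans_eq ?_
    rw [add_right_comm, add_assoc]
  have hfψ : ∀ n ω, (fn n ω).toENNReal ≤ ψ n ω := fun n ω => le_iInf fun m =>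
    (EReal.toENNReal_le_toENNReal (hmono (Nat.le_add_right n m) ω)).trans (hfφ _ ω)
  refine lt_of_le_of_lt ((upperInt_le_lintegral (φ := fun ω => ⨆ n, ψ n ω)
    (Measurable.iSup hψ) fun ω => ?_).trans ?_) hab
  · rw [← EReal.coe_ennreal_le_coe_ennreal_iff,
      EReal.coe_toENNReal ((h0 0 ω).trans (le_iSup (fun n => fn n ω) 0))]
    refine iSup_le fun n => (le_coe_of_toENNReal_le (hfψ n ω)).trans ?_
    exact EReal.coe_ennreal_le_coe_ennreal_iff.2 (le_iSup (fun n => ψ n ω) n)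
  · rw [lintegral_iSup hψ hψmono]
    have ha0 : 0 ≤ a := (EReal.coe_ennreal_nonneg _).trans (hφa 0).le
    rw [← EReal.coe_toENNReal ha0, EReal.coe_ennreal_le_coe_ennreal_iff]
    refine iSup_le fun n => ?_
    rw [← EReal.coe_ennreal_le_coe_ennreal_iff, EReal.coe_toENNReal ha0]
    refine le_trans (EReal.coe_ennreal_le_coe_ennreal_iff.2 (lintegral_mono fun ω => ?_)) (hφa n).le
    exact iInf_le (fun m => φ (n + m) ω) 0

end

theorem measurableSet_cyl (z : List X) : MeasurableSet (cyl z) :=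
  MeasurableSpace.measurableSet_generateFrom ⟨z, rfl⟩

/-- A path with a prescribed finite initial segment. -/
noncomputable def extendPath {n : ℕ} (z : Fin n → X) : Path X :=
  fun i => if h : i < n then z ⟨i, h⟩ else Classical.arbitrary X

theorem mem_cyl_ofFn {n : ℕ} (z : Fin n → X) (ω : Path X) :
    ω ∈ cyl (List.ofFn z) ↔ ∀ i : Fin n, ω i = z i := by
  constructor
  · intro h i
    have h' : prefixList ω (List.ofFn z).length = List.ofFn z := h
    have := congrArg (fun l => l[(i : ℕ)]?) h'
    simpa [prefixList] using this
  · intro h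
    refine List.ext_getElem (by simp) fun i h1 h2 => ?_
    have hi : i < n := by simpa using h2
    simpa [prefixList] using h ⟨i, hi⟩

theorem eq_sum_indicator_cyl {n : ℕ} {φ : Path X → ℝ≥0∞}
    (hφ : ∀ ω ω', prefixList ω n = prefixList ω' n → φ ω = φ ω') (ω : Path X) :
    φ ω = ∑ z : Fin n → X, (cyl (List.ofFn z)).indicator (fun _ => φ (extendPath z)) ω := by
  rw [Finset.sum_eq_single fun i : Fin n => ω i]
  · rw [Set.indicator_of_mem ((mem_cyl_ofFn _ _).2 fun i => rfl)]
    refine hφ _ _ ((prefixList_eq_iff _ _ _).2 fun i hi => ?_)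
    simp [extendPath, hi]
  · intro z _ hz
    refine Set.indicator_of_notMem (fun h => hz ?_) _
    exact funext fun i => ((mem_cyl_ofFn z ω).1 h i).symm
  · exact fun h => absurd (Finset.mem_univ _) h

theorem measurable_of_prefixList {n : ℕ} {φ : Path X → ℝ≥0∞}
    (hφ : ∀ ω ω', prefixList ω n = prefixList ω' n → φ ω = φ ω') : Measurable φ := by
  rw [funext (eq_sum_indicator_cyl hφ)]
  exact Finset.measurable_sum _ fun z _ => measurable_const.indicator (measurableSet_cyl _)

theorem IsTreeMeasure.lintegral_eq {p : PreciseTree X} {s : List X} {μ : Measure (Path X)}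
    (hμ : IsTreeMeasure p s μ) {n : ℕ} {φ : Path X → ℝ≥0∞}
    (hφ : ∀ ω ω', prefixList ω n = prefixList ω' n → φ ω = φ ω') :
    ∫⁻ ω, φ ω ∂μ =
      ∑ z : Fin n → X, φ (extendPath z) * ENNReal.ofReal (cylProb p.p s (List.ofFn z)) := by
  rw [lintegral_congr (eq_sum_indicator_cyl hφ),
    lintegral_finsetSum _ fun z _ => measurable_const.indicator (measurableSet_cyl _)]
  refine Finset.sum_congr rfl fun z _ => ?_
  rw [lintegral_indicator_const (measurableSet_cyl _), hμ.2]

theorem continuous_cylProb (s z : List X) :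
    Continuous fun q : List X → X → ℝ => cylProb q s z := by
  unfold cylProb
  split_ifs
  · fun_prop
  · exact continuous_const
  · exact continuous_const

namespace ImpreciseTree

theorem isCompact_sets (P : ImpreciseTree X) (s : List X) : IsCompact (P.sets s) := by
  refine (isCompact_Icc (a := (0 : X → ℝ)) (b := 1)).of_isClosed_subset (P.closed' s) fun q hq => ?_
  obtain ⟨h0, h1⟩ := P.prob' s q hq
  refine ⟨h0, fun x => ?_⟩
  rw [Pi.one_apply, ← h1]
  exact Finset.single_le_sum (fun y _ => h0 y) (Finset.mem_univ x)

/-- A selection of the credal sets as a precise tree. -/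
def toPrecise (P : ImpreciseTree X) (q : List X → X → ℝ) (hq : q ∈ Set.univ.pi P.sets) :
    PreciseTree X where
  p := q
  nonneg s := (P.prob' s _ (hq s trivial)).1
  sum_one s := (P.prob' s _ (hq s trivial)).2

theorem compatible_toPrecise (P : ImpreciseTree X) (q : List X → X → ℝ)
    (hq : q ∈ Set.univ.pi P.sets) : Compatible (P.toPrecise q hq) P :=
  fun s => hq s trivial

theorem exists_compatible (P : ImpreciseTree X) : ∃ p, Compatible p P := by
  choose q hq using P.nonempty'
  exact ⟨_, P.compatible_toPrecise q fun s _ => hq s⟩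

end ImpreciseTree

section

variable {P : ImpreciseTree X} {Pm : PreciseTree X → List X → Measure (Path X)} {s : List X}

theorem muUE_nonneg {f : Path X → EReal} (hf : ∀ ω, 0 ≤ f ω) : 0 ≤ muUE Pm P f s := by
  obtain ⟨p, hp⟩ := P.exists_compatible
  exact ((EReal.coe_ennreal_nonneg _).trans (lintegral_le_upperInt hf)).trans
    (le_iSup₂ (f := fun p (_ : Compatible p P) => upperInt (Pm p s) f) p hp)

theorem muUE_mono {f g : Path X → EReal} (hfg : ∀ ω, f ω ≤ g ω) :
    muUE Pm P f s ≤ muUE Pm P g s :=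
  iSup₂_mono fun _ _ => upperInt_mono hfg

theorem muUE_iSup {fn : ℕ → Path X → EReal} (h0 : ∀ n ω, 0 ≤ fn n ω) (hmono : Monotone fn) :
    muUE Pm P (fun ω => ⨆ n, fn n ω) s = ⨆ n, muUE Pm P (fn n) s := by
  apply le_antisymm
  · refine iSup₂_le fun p hp => (upperInt_iSup_le h0 hmono).trans (iSup_mono fun n => ?_)
    exact le_iSup₂ (f := fun p (_ : Compatible p P) => upperInt (Pm p s) (fn n)) p hp
  · exact iSup_le fun n => muUE_mono fun ω => le_iSup (fun n => fn n ω) n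

/-- By compactness of the set of compatible precise trees, the measure-theoretic upper
expectation is continuous along nonincreasing sequences whose `n`-th member depends only on the
first `n` states. -/
theorem iInf_muUE_le (hPm : ∀ p s, IsTreeMeasure p s (Pm p s)) {h : ℕ → Path X → ℝ}
    {g : Path X → ℝ} {c : ℝ} (hc : ∀ n ω, h n ω ≤ c) (hanti : Antitone h)
    (hmeas : ∀ n ω ω', prefixList ω n = prefixList ω' n → h n ω = h n ω') (hg0 : ∀ ω, 0 ≤ g ω)
    (hgh : ∀ n ω, g ω ≤ h n ω) (hlim : ∀ ω, ∀ r > g ω, ∃ n, h n ω < r) :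
    ⨅ n, muUE Pm P (fun ω => (h n ω : EReal)) s ≤ muUE Pm P (fun ω => (g ω : EReal)) s := by
  have hg0' : ∀ ω, 0 ≤ (g ω : EReal) := fun ω => EReal.coe_nonneg.2 (hg0 ω)
  have hφ : ∀ n ω ω', prefixList ω n = prefixList ω' n →
      ENNReal.ofReal (h n ω) = ENNReal.ofReal (h n ω') := fun n ω ω' heq => by
    rw [hmeas n ω ω' heq]
  have hφm : ∀ n, Measurable fun ω => ENNReal.ofReal (h n ω) := fun n =>
    measurable_of_prefixList (hφ n)
  have hφanti : Antitone fun n ω => ENNReal.ofReal (h n ω) := fun m n hmn ω =>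
    ENNReal.ofReal_le_ofReal (hanti hmn ω)
  let I : ℕ → (List X → X → ℝ) → ℝ≥0∞ := fun n q => ∑ z : Fin n → X,
    ENNReal.ofReal (h n (extendPath z)) * ENNReal.ofReal (cylProb q s (List.ofFn z))
  have hI : ∀ n, Continuous (I n) := fun n => continuous_finsetSum _ fun z _ =>
    (ENNReal.continuous_const_mul ENNReal.ofReal_ne_top).comp
      (ENNReal.continuous_ofReal.comp (continuous_cylProb s _))
  have hIp : ∀ n (p : PreciseTree X), I n p.p = ∫⁻ ω, ENNReal.ofReal (h n ω) ∂(Pm p s) :=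
    fun n p => ((hPm p s).lintegral_eq (hφ n)).symm
  refine le_of_forall_lt_imp_le_of_dense fun a ha => ?_
  rcases lt_or_ge a 0 with ha0 | ha0
  · exact ha0.le.trans (muUE_nonneg hg0')
  let K : ℕ → Set (List X → X → ℝ) := fun n => Set.univ.pi P.sets ∩ {q | a.toENNReal ≤ I n q}
  have hKcl : ∀ n, IsClosed {q | a.toENNReal ≤ I n q} := fun n =>
    isClosed_le continuous_const (hI n)
  have hcpt : IsCompact (Set.univ.pi P.sets) := isCompact_univ_pi P.isCompact_sets
  have hKanti : ∀ n, K (n + 1) ⊆ K n := by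
    rintro n q ⟨hq, hle⟩
    refine ⟨hq, hle.trans (?_ : I (n + 1) q ≤ I n q)⟩
    have h1 := hIp (n + 1) (P.toPrecise q hq)
    have h2 := hIp n (P.toPrecise q hq)
    change I (n + 1) q = _ at h1
    change I n q = _ at h2
    rw [h1, h2]
    exact lintegral_mono (hφanti n.le_succ)
  have hKne : ∀ n, (K n).Nonempty := by
    intro n
    have hn := ha.trans_le (iInf_le _ n)
    obtain ⟨p, hp⟩ := lt_iSup_iff.1 hn
    obtain ⟨hpP, hp⟩ := lt_iSup_iff.1 hp
    refine ⟨p.p, fun t _ => hpP t, ?_⟩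
    have := hp.le.trans (upperInt_le_lintegral (hφm n) fun ω => le_rfl)
    rw [← hIp, ← EReal.coe_toENNReal ha0, EReal.coe_ennreal_le_coe_ennreal_iff] at this
    exact this
  obtain ⟨q, hq⟩ := IsCompact.nonempty_iInter_of_sequence_nonempty_isCompact_isClosed K hKanti hKne
    (hcpt.inter_right (hKcl 0)) fun n => hcpt.isClosed.inter (hKcl n)
  rw [Set.mem_iInter] at hq
  let p : PreciseTree X := P.toPrecise q (hq 0).1
  have hle : a.toENNReal ≤ ∫⁻ ω, ENNReal.ofReal (g ω) ∂(Pm p s) := by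
    have hprob := (hPm p s).1
    have hfin : ∫⁻ ω, ENNReal.ofReal (h 0 ω) ∂(Pm p s) ≠ ⊤ := by
      refine ne_top_of_le_ne_top ?_ (lintegral_mono fun ω => ENNReal.ofReal_le_ofReal (hc 0 ω))
      simp
    calc a.toENNReal ≤ ⨅ n, ∫⁻ ω, ENNReal.ofReal (h n ω) ∂(Pm p s) :=
          le_iInf fun n => (hq n).2.trans (hIp n p).le
      _ = ∫⁻ ω, ⨅ n, ENNReal.ofReal (h n ω) ∂(Pm p s) := (lintegral_iInf hφm hφanti hfin).symm
      _ ≤ ∫⁻ ω, ENNReal.ofReal (g ω) ∂(Pm p s) := by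
        refine lintegral_mono fun ω => ?_
        have hlim' : Tendsto (fun n => h n ω) atTop (𝓝 (g ω)) := by
          refine tendsto_order.2 ⟨fun r hr => .of_forall fun n => hr.trans_le (hgh n ω),
            fun r hr => ?_⟩
          obtain ⟨n, hn⟩ := hlim ω r hr
          filter_upwards [eventually_ge_atTop n] with m hm
          exact (hanti hm ω).trans_lt hn
        exact ge_of_tendsto' (ENNReal.tendsto_ofReal hlim') fun n => iInf_le _ n
  calc a = (a.toENNReal : EReal) := (EReal.coe_toENNReal ha0).symm
    _ ≤ ((∫⁻ ω, ENNReal.ofReal (g ω) ∂(Pm p s) : ℝ≥0∞) : EReal) :=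
        EReal.coe_ennreal_le_coe_ennreal_iff.2 hle
    _ ≤ upperInt (Pm p s) fun ω => (g ω : EReal) := lintegral_le_upperInt hg0'
    _ ≤ muUE Pm P (fun ω => (g ω : EReal)) s :=
        le_iSup₂ (f := fun p (_ : Compatible p P) => upperInt (Pm p s) fun ω => (g ω : EReal)) p
          (P.compatible_toPrecise q (hq 0).1)

theorem isCapacity_muUE [TopologicalSpace X] [DiscreteTopology X]
    (hPm : ∀ p s, IsTreeMeasure p s (Pm p s)) : IsCapacity fun f => muUE Pm P f s := by
  refine ⟨fun f hf => muUE_nonneg hf, fun f g _ _ hfg => muUE_mono hfg,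
    fun fn h0 hmono => ?_, fun fn hfn husc hanti => ?_⟩
  · dsimp only
    rw [muUE_iSup h0 hmono]
    exact tendsto_atTop_iSup fun m n hmn => muUE_mono (hmono hmn)
  · exact tendsto_of_antitone_usc (F := fun f => muUE Pm P f s) (fun f g _ _ hfg => muUE_mono hfg)
      (fun c h g hc hh hmeas hg0 hgh hlim => iInf_muUE_le hPm hc hh hmeas hg0 hgh hlim)
      hfn husc hanti

end

theorem stmt19 [TopologicalSpace X] [DiscreteTopology X]
    (P : ImpreciseTree X) (Q : UpperExpTree X)
    (Pm : PreciseTree X → List X → Measure (Path X))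
    (hPm : ∀ (p : PreciseTree X) (s : List X), IsTreeMeasure p s (Pm p s))
    (s : List X) :
    IsCapacity (fun f => muUE Pm P f s) ∧ IsCapacity (fun f => gtUE Q f s) := by
  exact ⟨isCapacity_muUE hPm, isCapacity_gtUE Q s⟩

end UEPaper
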